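/- In the even Clifford algebra A of the quadratic form diag(1,1,0) on ℂ³, the elements e₊ = (1/2)·(1 + x) and e₋ = (1/2)·(1 − x) form a complete set of primitive orthogonal idempotents: e₊² = e₊, e₋² = e₋, e₊·e₋ = e₋·e₊ = 0, e₊ + e₋ = 1, and each of e₊ and e₋ is primitive, i.e. whenever it equals f + g for idempotents f, g ∈ A with f·g = g·f = 0, then f = 0 or g = 0. -/

import Mathlib

open CliffordAlgebra

noncomputable section

/-- The quadratic form `v ↦ v₀² + v₁²` on `ℂ³`, with Gram matrix `diag(1,1,0)` —
the quadratic form of a corank-1 degenerate conic. -/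
def Q : QuadraticForm ℂ (Fin 3 → ℂ) := QuadraticMap.weightedSumSquares ℂ ![1, 1, 0]

/-- The standard basis vectors `e₁, e₂, e₃` of `ℂ³` (indexed by `0, 1, 2`). -/
def e (j : Fin 3) : Fin 3 → ℂ := Pi.single j 1

/-- `x = i·ι(e₁)·ι(e₂)` in the Clifford algebra of `Q`. -/
def x : CliffordAlgebra Q := Complex.I • (ι Q (e 0) * ι Q (e 1))

/-- `y = i·ι(e₂)·ι(e₃)` in the Clifford algebra of `Q`. -/
def y : CliffordAlgebra Q := Complex.I • (ι Q (e 1) * ι Q (e 2))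

/-- `z = ι(e₁)·ι(e₃)` in the Clifford algebra of `Q`. -/
def z : CliffordAlgebra Q := ι Q (e 0) * ι Q (e 2)

lemma x_mem : x ∈ even Q := Subalgebra.smul_mem _ (ι_mul_ι_mem_evenOdd_zero Q _ _) _

lemma y_mem : y ∈ even Q := Subalgebra.smul_mem _ (ι_mul_ι_mem_evenOdd_zero Q _ _) _

lemma z_mem : z ∈ even Q := ι_mul_ι_mem_evenOdd_zero Q _ _

/-- `x` as an element of the even Clifford algebra `A = CliffordAlgebra.even Q`. -/
def xA : even Q := ⟨x, x_mem⟩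

/-- `y` as an element of the even Clifford algebra `A = CliffordAlgebra.even Q`. -/
def yA : even Q := ⟨y, y_mem⟩

/-- `z` as an element of the even Clifford algebra `A = CliffordAlgebra.even Q`. -/
def zA : even Q := ⟨z, z_mem⟩

/-- `e₊ = (1/2)·(1 + x)` in the even Clifford algebra `A`. -/
def ePlus : even Q := (2 : ℂ)⁻¹ • (1 + xA)

/-- `e₋ = (1/2)·(1 − x)` in the even Clifford algebra `A`. -/
def eMinus : even Q := (2 : ℂ)⁻¹ • (1 - xA)

lemma Q_e_zero : Q (e 0) = 1 := by
  simp [Q, e, QuadraticMap.weightedSumSquares_apply, Fin.sum_univ_three]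

lemma Q_e_one : Q (e 1) = 1 := by
  simp [Q, e, QuadraticMap.weightedSumSquares_apply, Fin.sum_univ_three]

lemma Q_e_two : Q (e 2) = 0 := by
  simp [Q, e, QuadraticMap.weightedSumSquares_apply, Fin.sum_univ_three]

lemma ι_e_zero_mul_self : ι Q (e 0) * ι Q (e 0) = 1 := by
  rw [ι_sq_scalar, Q_e_zero, map_one]

lemma ι_e_one_mul_self : ι Q (e 1) * ι Q (e 1) = 1 := by
  rw [ι_sq_scalar, Q_e_one, map_one]

lemma ι_e_two_mul_self : ι Q (e 2) * ι Q (e 2) = 0 := by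
  rw [ι_sq_scalar, Q_e_two, map_zero]

/-- Distinct standard basis vectors are orthogonal, so they anticommute. -/
lemma ι_e_mul_ι_e_of_ne {i j : Fin 3} (h : i ≠ j) :
    ι Q (e i) * ι Q (e j) = -(ι Q (e j) * ι Q (e i)) := by
  refine ι_mul_ι_comm_of_isOrtho ?_
  rw [QuadraticMap.isOrtho_def]
  fin_cases i <;> fin_cases j <;>
    simp_all [Q, e, QuadraticMap.weightedSumSquares_apply, Fin.sum_univ_three]

/-- The products of two elements of the even part, in terms of anticommuting generators
`a, b, c` with squares `1, 1, 0`. -/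
lemma even_products {R : Type*} [Ring R] {a b c : R} (ha : a * a = 1) (hb : b * b = 1)
    (hc : c * c = 0) (hba : b * a = -(a * b)) (hca : c * a = -(a * c))
    (hcb : c * b = -(b * c)) :
    (a * b) * (a * b) = -1 ∧ (a * b) * (b * c) = a * c ∧ (a * b) * (a * c) = -(b * c) ∧
    (b * c) * (a * b) = -(a * c) ∧ (b * c) * (b * c) = 0 ∧ (b * c) * (a * c) = 0 ∧
    (a * c) * (a * b) = b * c ∧ (a * c) * (b * c) = 0 ∧ (a * c) * (a * c) = 0 := by
  have ha' (t : R) : a * (a * t) = t := by rw [← mul_assoc, ha, one_mul]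
  have hb' (t : R) : b * (b * t) = t := by rw [← mul_assoc, hb, one_mul]
  have hba' (t : R) : b * (a * t) = -(a * (b * t)) := by
    rw [← mul_assoc, hba, neg_mul, mul_assoc]
  have hca' (t : R) : c * (a * t) = -(a * (c * t)) := by
    rw [← mul_assoc, hca, neg_mul, mul_assoc]
  have hcb' (t : R) : c * (b * t) = -(b * (c * t)) := by
    rw [← mul_assoc, hcb, neg_mul, mul_assoc]
  simp [mul_assoc, ha, hb, hc, hcb, ha', hb', hba', hca', hcb']

lemma xyz_products :
    x * x = 1 ∧ x * y = -z ∧ x * z = -y ∧ y * x = z ∧ y * y = 0 ∧ y * z = 0 ∧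
    z * x = y ∧ z * y = 0 ∧ z * z = 0 := by
  obtain ⟨h₁, h₂, h₃, h₄, h₅, h₆, h₇, h₈, h₉⟩ :=
    even_products ι_e_zero_mul_self ι_e_one_mul_self ι_e_two_mul_self
      (ι_e_mul_ι_e_of_ne (i := 1) (j := 0) (by decide))
      (ι_e_mul_ι_e_of_ne (i := 2) (j := 0) (by decide))
      (ι_e_mul_ι_e_of_ne (i := 2) (j := 1) (by decide))
  simp [x, y, z, h₁, h₂, h₃, h₄, h₅, h₆, h₇, h₈, h₉, smul_smul]

lemma ι_eq_sum (v : Fin 3 → ℂ) :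
    ι Q v = v 0 • ι Q (e 0) + v 1 • ι Q (e 1) + v 2 • ι Q (e 2) := by
  rw [← map_smul, ← map_smul, ← map_smul, ← map_add, ← map_add]
  congr 1
  ext j
  fin_cases j <;> simp [e]

lemma ι_mul_ι_eq (v w : Fin 3 → ℂ) :
    ∃ a b c d : ℂ, ι Q v * ι Q w = a • 1 + b • x + c • y + d • z := by
  refine ⟨v 0 * w 0 + v 1 * w 1, -Complex.I * (v 0 * w 1 - v 1 * w 0),
    -Complex.I * (v 1 * w 2 - v 2 * w 1), v 0 * w 2 - v 2 * w 0, ?_⟩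
  have hI (t : ℂ) : -Complex.I * t * Complex.I = t := by
    linear_combination -t * Complex.I_mul_I
  rw [ι_eq_sum v, ι_eq_sum w]
  simp only [x, y, z, smul_smul, hI, add_mul, mul_add, smul_mul_assoc, mul_smul_comm,
    ι_e_zero_mul_self, ι_e_one_mul_self, ι_e_two_mul_self,
    ι_e_mul_ι_e_of_ne (i := 1) (j := 0) (by decide),
    ι_e_mul_ι_e_of_ne (i := 2) (j := 0) (by decide),
    ι_e_mul_ι_e_of_ne (i := 2) (j := 1) (by decide)]
  module

/-- The even Clifford algebra is spanned by `1, x, y, z`. -/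
lemma exists_eq_of_mem_even {t : CliffordAlgebra Q} (ht : t ∈ even Q) :
    ∃ a b c d : ℂ, t = a • 1 + b • x + c • y + d • z := by
  induction t, ht using even_induction with
  | algebraMap r => exact ⟨r, 0, 0, 0, by simp [Algebra.algebraMap_eq_smul_one]⟩
  | add s t _ _ hs ht =>
    obtain ⟨a, b, c, d, rfl⟩ := hs
    obtain ⟨a', b', c', d', rfl⟩ := ht
    exact ⟨a + a', b + b', c + c', d + d', by module⟩
  | ι_mul_ι_mul v w t _ ht =>
    obtain ⟨a, b, c, d, h⟩ := ι_mul_ι_eq v w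
    obtain ⟨a', b', c', d', rfl⟩ := ht
    obtain ⟨h₁, h₂, h₃, h₄, h₅, h₆, h₇, h₈, h₉⟩ := xyz_products
    refine ⟨a * a' + b * b', a * b' + b * a', a * c' + c * a' - b * d' + d * b',
      a * d' + d * a' - b * c' + c * b', ?_⟩
    rw [h]
    simp only [add_mul, mul_add, smul_mul_assoc, mul_smul_comm, one_mul, mul_one,
      h₁, h₂, h₃, h₄, h₅, h₆, h₇, h₈, h₉]
    module

lemma xA_mul_xA : xA * xA = 1 := Subtype.ext xyz_products.1

lemma xA_mul_yA : xA * yA = -(yA * xA) :=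
  Subtype.ext (by
    obtain ⟨-, h₂, -, h₄, -⟩ := xyz_products
    exact h₂.trans (congrArg Neg.neg h₄.symm))

lemma xA_mul_zA : xA * zA = -(zA * xA) :=
  Subtype.ext (by
    obtain ⟨-, -, h₃, -, -, -, h₇, -⟩ := xyz_products
    exact h₃.trans (congrArg Neg.neg h₇.symm))

lemma exists_eq_smul_add (t : even Q) :
    ∃ a b c d : ℂ, t = a • 1 + b • xA + c • yA + d • zA := by
  obtain ⟨a, b, c, d, h⟩ := exists_eq_of_mem_even t.2
  exact ⟨a, b, c, d, Subtype.ext h⟩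

section Idempotents

variable {R : Type*} [Ring R] [Algebra ℂ R]

/-- If `s² = 1` and `s` anticommutes with `t`, the corner of `½(1 + s)` kills `t`. -/
lemma half_one_add_corner_eq_zero {s t : R} (hs : s * s = 1) (hst : s * t = -(t * s)) :
    ((2 : ℂ)⁻¹ • (1 + s)) * t * ((2 : ℂ)⁻¹ • (1 + s)) = 0 := by
  have h : (1 + s) * t * (1 + s) = 0 := by
    have : s * t * s = -t := by rw [hst, neg_mul, mul_assoc, hs, mul_one]
    simp only [add_mul, mul_add, one_mul, mul_one, this]
    rw [hst]
    abel
  rw [smul_mul_assoc, smul_mul_assoc, mul_smul_comm, h, smul_zero, smul_zero]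

lemma half_one_add_mul_self {s : R} (hs : s * s = 1) :
    ((2 : ℂ)⁻¹ • (1 + s)) * ((2 : ℂ)⁻¹ • (1 + s)) = (2 : ℂ)⁻¹ • (1 + s) := by
  simp only [smul_mul_assoc, mul_smul_comm, add_mul, mul_add, one_mul, mul_one, hs]
  module

lemma half_one_add_mul {s : R} (hs : s * s = 1) :
    ((2 : ℂ)⁻¹ • (1 + s)) * s = (2 : ℂ)⁻¹ • (1 + s) := by
  rw [smul_mul_assoc, add_mul, one_mul, hs, add_comm]

/-- An idempotent `p` whose corner `pRp` consists of scalar multiples of `p` is primitive. -/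
lemma eq_zero_or_eq_zero_of_corner_scalar {p : R} (hp : ∀ t : R, ∃ k : ℂ, p * t * p = k • p)
    {f g : R} (hf : f * f = f) (hfg : f * g = 0) (hgf : g * f = 0)
    (h : p = f + g) : f = 0 ∨ g = 0 := by
  have hpf : p * f * p = f := by simp [h, add_mul, mul_add, hf, hfg, hgf]
  obtain ⟨k, hk⟩ := hp f
  rw [hpf] at hk
  have hkg : k • g = 0 := by
    have hg : f = k • f + k • g := by rw [← smul_add, ← h, ← hk]
    have hff : f = k • f := by
      calc f = f * f := hf.symm
        _ = (k • p) * f := by rw [← hk]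
        _ = k • f := by rw [smul_mul_assoc, h, add_mul, hf, hgf, add_zero]
    rw [← hff] at hg
    exact left_eq_add.mp hg
  rcases smul_eq_zero.mp hkg with rfl | hg
  · exact Or.inl (by rw [hk, zero_smul])
  · exact Or.inr hg

end Idempotents

lemma corner_ePlus (t : even Q) : ∃ k : ℂ, ePlus * t * ePlus = k • ePlus := by
  obtain ⟨a, b, c, d, rfl⟩ := exists_eq_smul_add t
  refine ⟨a + b, ?_⟩
  have hpp : ePlus * ePlus = ePlus := half_one_add_mul_self xA_mul_xA
  have hpx : ePlus * xA = ePlus := half_one_add_mul xA_mul_xA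
  have hpy : ePlus * yA * ePlus = 0 := half_one_add_corner_eq_zero xA_mul_xA xA_mul_yA
  have hpz : ePlus * zA * ePlus = 0 := half_one_add_corner_eq_zero xA_mul_xA xA_mul_zA
  simp only [mul_add, add_mul, mul_smul_comm, smul_mul_assoc, mul_one, hpp, hpx, hpy, hpz]
  module

lemma eMinus_eq : eMinus = (2 : ℂ)⁻¹ • (1 + -xA) := by rw [eMinus, sub_eq_add_neg]

lemma neg_xA_mul_neg_xA : -xA * -xA = 1 := by rw [neg_mul_neg, xA_mul_xA]

lemma eMinus_mul_self : eMinus * eMinus = eMinus := by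
  rw [eMinus_eq]
  exact half_one_add_mul_self neg_xA_mul_neg_xA

lemma corner_eMinus (t : even Q) : ∃ k : ℂ, eMinus * t * eMinus = k • eMinus := by
  obtain ⟨a, b, c, d, rfl⟩ := exists_eq_smul_add t
  refine ⟨a - b, ?_⟩
  have hpp := eMinus_mul_self
  have hpx : eMinus * xA = -eMinus := by
    have h := half_one_add_mul neg_xA_mul_neg_xA
    rw [← eMinus_eq, mul_neg] at h
    exact neg_eq_iff_eq_neg.mp h
  have hpy : eMinus * yA * eMinus = 0 := by
    rw [eMinus_eq]
    exact half_one_add_corner_eq_zero neg_xA_mul_neg_xA (by rw [neg_mul, xA_mul_yA, mul_neg])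
  have hpz : eMinus * zA * eMinus = 0 := by
    rw [eMinus_eq]
    exact half_one_add_corner_eq_zero neg_xA_mul_neg_xA (by rw [neg_mul, xA_mul_zA, mul_neg])
  simp only [mul_add, add_mul, mul_smul_comm, smul_mul_assoc, mul_one, neg_mul, hpp, hpx, hpy, hpz]
  module

set_option maxHeartbeats 1000000 in
/-- In the even Clifford algebra `A` of `diag(1,1,0)` on `ℂ³`, the elements
`e₊ = (1/2)(1+x)` and `e₋ = (1/2)(1−x)` form a complete set of primitive orthogonal
idempotents: `e₊² = e₊`, `e₋² = e₋`, `e₊·e₋ = e₋·e₊ = 0`, `e₊ + e₋ = 1`, and each of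
`e₊`, `e₋` is primitive, i.e. whenever it equals `f + g` for idempotents `f, g ∈ A`
with `f·g = g·f = 0`, then `f = 0` or `g = 0`. -/
theorem complete_primitive_orthogonal_idempotents :
    ePlus * ePlus = ePlus ∧ eMinus * eMinus = eMinus ∧
    ePlus * eMinus = 0 ∧ eMinus * ePlus = 0 ∧ ePlus + eMinus = 1 ∧
    (∀ f g : even Q, f * f = f → g * g = g → f * g = 0 → g * f = 0 →
      ePlus = f + g → f = 0 ∨ g = 0) ∧
    (∀ f g : even Q, f * f = f → g * g = g → f * g = 0 → g * f = 0 →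
      eMinus = f + g → f = 0 ∨ g = 0) := by
  have hpp : ePlus * ePlus = ePlus := half_one_add_mul_self xA_mul_xA
  have hadd : ePlus + eMinus = 1 := by
    rw [ePlus, eMinus]
    module
  have hm : eMinus = 1 - ePlus := eq_sub_of_add_eq' hadd
  refine ⟨hpp, eMinus_mul_self, ?_, ?_, hadd, ?_, ?_⟩
  · rw [hm, mul_sub, mul_one, hpp, sub_self]
  · rw [hm, sub_mul, one_mul, hpp, sub_self]
  · intro f g hf _ hfg hgf h
    exact eq_zero_or_eq_zero_of_corner_scalar corner_ePlus hf hfg hgf h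
  · intro f g hf _ hfg hgf h
    exact eq_zero_or_eq_zero_of_corner_scalar corner_eMinus hf hfg hgf h
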